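/- For every ε > 0 there exists a constant C > 0 such that for all primes p, all real T ≥ 1, and every subset S ⊆ {1, …, p−1}, one has Σ_{v∈S} R_{T,p}(v) ≤ (6/π²)·(T²/p)·#S + C·(T²·p^{−1} + T·p^{1/2+ε}). -/

import Mathlib

/-- `R_{T,p}(v)`: the number of pairs `(α, β)` of coprime integers with
`1 ≤ α, β ≤ T`, `gcd(β, p) = 1`, and `α ≡ v·β (mod p)`. -/
noncomputable def RTp (T : ℝ) (p : ℕ) (v : ℤ) : ℕ :=
  ((Finset.Icc 1 ⌊T⌋₊ ×ˢ Finset.Icc 1 ⌊T⌋₊).filter fun ab =>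
    Nat.Coprime ab.1 ab.2 ∧ Nat.Coprime ab.2 p ∧
      (ab.1 : ZMod p) = (v : ZMod p) * (ab.2 : ZMod p)).card

lemma sum_Icc_one_div_le (n : ℕ) : ∑ k ∈ Finset.Icc 1 n, 1 / (k : ℝ) ≤ 1 + Real.log n := by
  have h := harmonic_le_one_add_log n
  rw [harmonic_eq_sum_Icc] at h
  push_cast at h
  simpa only [one_div] using h

/-- The number of `(a, b) ∈ [1, m]²` with `a = v * b` in `ZMod p`. -/
def pairCount (m p : ℕ) (v : ZMod p) : ℕ :=
  ((Finset.Icc 1 m ×ˢ Finset.Icc 1 m).filter fun ab => (ab.1 : ZMod p) = v * (ab.2 : ZMod p)).card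

/-- The exponential sum of the interval `[1, m]` at the frequency `h` modulo `p`. -/
noncomputable def intervalSum (m p : ℕ) [NeZero p] (h : ZMod p) : ℂ :=
  ∑ a ∈ Finset.Icc 1 m, ZMod.stdAddChar (h * (a : ZMod p))

lemma intervalSum_zero (m p : ℕ) [NeZero p] : intervalSum m p 0 = m := by
  simp [intervalSum]

lemma mul_pairCount (m p : ℕ) [NeZero p] (v : ZMod p) :
    (p : ℂ) * pairCount m p v = ∑ h, intervalSum m p h * intervalSum m p (-(h * v)) := by
  have key : ∀ a b : ℕ, (∑ h : ZMod p, ZMod.stdAddChar (h * (a : ZMod p)) *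
      ZMod.stdAddChar (-(h * v) * (b : ZMod p)) : ℂ) =
      if (a : ZMod p) = v * b then (p : ℂ) else 0 := by
    intro a b
    have := AddChar.sum_mulShift ((a : ZMod p) - v * b) (ZMod.isPrimitive_stdAddChar p)
    simp only [ZMod.card, sub_eq_zero, Nat.cast_ite, Nat.cast_zero] at this
    rw [← this]
    refine Finset.sum_congr rfl fun h _ => ?_
    rw [← AddChar.map_add_eq_mul]
    congr 1
    ring
  simp only [intervalSum, Finset.sum_mul_sum]
  rw [Finset.sum_comm]
  conv_rhs => enter [2, a]; rw [Finset.sum_comm]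
  simp only [key]
  rw [← Finset.sum_product', pairCount, ← Finset.sum_filter, Finset.sum_const, nsmul_eq_mul,
    mul_comm]

lemma norm_stdAddChar_sub_one {p : ℕ} [NeZero p] (h : ZMod p) :
    ‖(ZMod.stdAddChar h : ℂ) - 1‖ = 2 * Real.sin (Real.pi * h.val / p) := by
  have hp : (0 : ℝ) < p := Nat.cast_pos.2 (NeZero.pos p)
  have h1 : (ZMod.stdAddChar h : ℂ) =
      Complex.exp (Complex.I * ((2 * Real.pi * h.val / p : ℝ) : ℂ)) := by
    rw [ZMod.stdAddChar_apply, ZMod.toCircle_apply]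
    congr 1
    push_cast
    ring
  rw [h1, Complex.norm_exp_I_mul_ofReal_sub_one, Real.norm_of_nonneg]
  · congr 2; ring
  · refine mul_nonneg zero_le_two (Real.sin_nonneg_of_nonneg_of_le_pi (by positivity) ?_)
    have : (h.val : ℝ) ≤ p := by exact_mod_cast (ZMod.val_lt h).le
    rw [div_div, div_le_iff₀ (by positivity)]
    nlinarith [Real.pi_pos]

/-- A concavity bound for the inverse of `sin (π x)` on `(0, 1)`. -/
lemma one_div_sin_pi_mul_le {x : ℝ} (h0 : 0 < x) (h1 : x < 1) :
    1 / Real.sin (Real.pi * x) ≤ (1 / x + 1 / (1 - x)) / 2 := by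
  have aux : ∀ y : ℝ, 0 < y → y ≤ 1 / 2 → 2 * y ≤ Real.sin (Real.pi * y) := by
    intro y hy hy2
    have := Real.mul_le_sin (x := Real.pi * y) (by positivity) (by nlinarith [Real.pi_pos])
    calc 2 * y = 2 / Real.pi * (Real.pi * y) := by field_simp
      _ ≤ _ := this
  have hx' : 0 < 1 - x := by linarith
  have hi : 0 < 1 / x := by positivity
  have hi' : 0 < 1 / (1 - x) := by positivity
  rcases le_total x (1 / 2) with hx | hx
  · calc 1 / Real.sin (Real.pi * x) ≤ 1 / (2 * x) :=
        one_div_le_one_div_of_le (by positivity) (aux x h0 hx)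
      _ = 1 / x / 2 := by field_simp
      _ ≤ _ := by linarith
  · have := aux (1 - x) hx' (by linarith)
    rw [show Real.pi * (1 - x) = Real.pi - Real.pi * x by ring, Real.sin_pi_sub] at this
    calc 1 / Real.sin (Real.pi * x) ≤ 1 / (2 * (1 - x)) :=
        one_div_le_one_div_of_le (by positivity) this
      _ = 1 / (1 - x) / 2 := by field_simp
      _ ≤ _ := by linarith

lemma norm_intervalSum_le (m : ℕ) {p : ℕ} [NeZero p] {h : ZMod p} (hh : h ≠ 0) :
    ‖intervalSum m p h‖ ≤ p / 2 * (1 / (h.val : ℝ) + 1 / ((p : ℝ) - h.val)) := by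
  have hp : (0 : ℝ) < p := Nat.cast_pos.2 (NeZero.pos p)
  have hv : (0 : ℝ) < h.val := by
    exact_mod_cast Nat.pos_of_ne_zero (by rwa [Ne, ZMod.val_eq_zero])
  have hv' : (h.val : ℝ) < p := by exact_mod_cast ZMod.val_lt h
  have hx1 : (h.val : ℝ) / p < 1 := (div_lt_one hp).2 hv'
  set z : ℂ := ZMod.stdAddChar h with hz
  have hzn : ‖z‖ = 1 := by rw [hz, ZMod.stdAddChar_apply]; exact Circle.norm_coe _
  have hs : 0 < Real.sin (Real.pi * (h.val / p)) := by
    refine Real.sin_pos_of_pos_of_lt_pi (by positivity) ?_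
    nlinarith [Real.pi_pos]
  have hz1 : ‖z - 1‖ = 2 * Real.sin (Real.pi * (h.val / p)) := by
    rw [hz, norm_stdAddChar_sub_one, mul_div_assoc]
  have hgeom : intervalSum m p h * (z - 1) = z * (z ^ m - 1) := by
    have hpow : ∀ a : ℕ, (ZMod.stdAddChar (h * (a : ZMod p)) : ℂ) = z ^ a := by
      intro a
      rw [hz, ← AddChar.map_nsmul_eq_pow, nsmul_eq_mul, mul_comm]
    simp only [intervalSum, hpow]
    induction m with
    | zero => simp
    | succ m ih => rw [Finset.sum_Icc_succ_top (by omega), add_mul, ih]; ring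
  have hle : ‖intervalSum m p h‖ * (2 * Real.sin (Real.pi * (h.val / p))) ≤ 2 := by
    rw [← hz1, ← norm_mul, hgeom, norm_mul, hzn, one_mul]
    refine (norm_sub_le _ _).trans ?_
    rw [norm_pow, hzn]
    norm_num
  calc ‖intervalSum m p h‖ ≤ 1 / Real.sin (Real.pi * (h.val / p)) := by
        rw [le_div_iff₀ hs]; linarith
    _ ≤ (1 / (h.val / p) + 1 / (1 - h.val / p)) / 2 :=
        one_div_sin_pi_mul_le (by positivity) hx1
    _ = _ := by
        have : (p : ℝ) - h.val ≠ 0 := by linarith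
        have h3 : (1 : ℝ) - h.val / p ≠ 0 := by linarith
        field_simp

lemma sum_norm_intervalSum_le (m p : ℕ) [NeZero p] :
    ∑ h ∈ Finset.univ.erase (0 : ZMod p), ‖intervalSum m p h‖ ≤ p * (1 + Real.log p) := by
  have hH : ∑ k ∈ Finset.Icc 1 (p - 1), 1 / (k : ℝ) ≤ 1 + Real.log p := by
    refine (Finset.sum_le_sum_of_subset_of_nonneg (Finset.Icc_subset_Icc_right (Nat.sub_le p 1))
      fun _ _ _ => by positivity).trans (sum_Icc_one_div_le p)
  have hH' : ∑ k ∈ Finset.Icc 1 (p - 1), 1 / ((p : ℝ) - k) =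
      ∑ k ∈ Finset.Icc 1 (p - 1), 1 / (k : ℝ) := by
    refine Finset.sum_bij' (fun k _ => p - k) (fun k _ => p - k) ?_ ?_ ?_ ?_ ?_
    · intro k hk; simp at hk ⊢; omega
    · intro k hk; simp at hk ⊢; omega
    · intro k hk; simp at hk ⊢; omega
    · intro k hk; simp at hk ⊢; omega
    · intro k hk
      simp only [Finset.mem_Icc] at hk
      rw [Nat.cast_sub (by omega)]
  calc ∑ h ∈ Finset.univ.erase (0 : ZMod p), ‖intervalSum m p h‖
      ≤ ∑ h ∈ Finset.univ.erase (0 : ZMod p),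
          p / 2 * (1 / (h.val : ℝ) + 1 / ((p : ℝ) - h.val)) :=
        Finset.sum_le_sum fun h hh => norm_intervalSum_le m (Finset.ne_of_mem_erase hh)
    _ = ∑ k ∈ Finset.Icc 1 (p - 1), p / 2 * (1 / (k : ℝ) + 1 / ((p : ℝ) - k)) := by
        refine Finset.sum_bij' (fun h _ => h.val) (fun k _ => (k : ZMod p)) ?_ ?_ ?_ ?_ ?_
        · intro h hh
          have h1 := ZMod.val_lt h
          have h2 : h.val ≠ 0 := by
            rw [Ne, ZMod.val_eq_zero]; exact Finset.ne_of_mem_erase hh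
          simp only [Finset.mem_Icc]; omega
        · intro k hk
          simp only [Finset.mem_Icc] at hk
          simp only [Finset.mem_erase, Finset.mem_univ, and_true, Ne, ZMod.natCast_eq_zero_iff]
          exact Nat.not_dvd_of_pos_of_lt (by omega) (by omega)
        · intro h _; simp
        · intro k hk
          simp only [Finset.mem_Icc] at hk
          exact ZMod.val_cast_of_lt (by omega)
        · intro h _; rfl
    _ = p * ∑ k ∈ Finset.Icc 1 (p - 1), 1 / (k : ℝ) := by
        rw [← Finset.mul_sum, Finset.sum_add_distrib, hH']; ring
    _ ≤ _ := by gcongr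

lemma abs_sum_pairCount_sub_le (m : ℕ) {p : ℕ} [Fact p.Prime] {S : Finset (ZMod p)} (hS : 0 ∉ S) :
    |∑ v ∈ S, ((pairCount m p v : ℝ) - (m : ℝ) ^ 2 / p)| ≤ p * (1 + Real.log p) ^ 2 := by
  have hp : (0 : ℝ) < p := Nat.cast_pos.2 (NeZero.pos p)
  set F := fun h => ‖intervalSum m p h‖ with hF
  set B := ∑ h ∈ Finset.univ.erase (0 : ZMod p), F h with hB
  have hB0 : 0 ≤ B := Finset.sum_nonneg fun _ _ => norm_nonneg _
  have hone : ∀ v, |(pairCount m p v : ℝ) - (m : ℝ) ^ 2 / p| ≤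
      1 / p * ∑ h ∈ Finset.univ.erase (0 : ZMod p), F h * F (-(h * v)) := by
    intro v
    have h1 := mul_pairCount m p v
    rw [← Finset.add_sum_erase _ _ (Finset.mem_univ (0 : ZMod p))] at h1
    simp only [zero_mul, neg_zero, intervalSum_zero] at h1
    have h2 : ((p * (pairCount m p v : ℝ) - (m : ℝ) ^ 2 : ℝ) : ℂ) =
        ∑ h ∈ Finset.univ.erase (0 : ZMod p), intervalSum m p h * intervalSum m p (-(h * v)) := by
      push_cast
      rw [h1]; ring
    have h3 : |(p * (pairCount m p v : ℝ) - (m : ℝ) ^ 2 : ℝ)| ≤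
        ∑ h ∈ Finset.univ.erase (0 : ZMod p), F h * F (-(h * v)) := by
      rw [← Real.norm_eq_abs, ← Complex.norm_real, h2]
      refine (norm_sum_le _ _).trans (le_of_eq ?_)
      simp only [norm_mul, hF]
    have h4 : (pairCount m p v : ℝ) - (m : ℝ) ^ 2 / p =
        1 / p * (p * (pairCount m p v : ℝ) - (m : ℝ) ^ 2) := by field_simp
    rw [h4, abs_mul, abs_of_pos (by positivity)]
    gcongr
  have hinner : ∀ h ∈ Finset.univ.erase (0 : ZMod p), ∑ v ∈ S, F (-(h * v)) ≤ B := by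
    intro h hh
    have hh0 := Finset.ne_of_mem_erase hh
    have hinj : Set.InjOn (fun v => -(h * v)) (S : Set (ZMod p)) := by
      intro a _ b _ hab
      exact mul_left_cancel₀ hh0 (neg_injective hab)
    rw [← Finset.sum_image (f := F) hinj]
    refine Finset.sum_le_sum_of_subset_of_nonneg ?_ fun _ _ _ => norm_nonneg _
    intro x hx
    obtain ⟨v, hv, rfl⟩ := Finset.mem_image.1 hx
    have hv0 : v ≠ 0 := fun e => hS (e ▸ hv)
    simp [hh0, hv0]
  calc |∑ v ∈ S, ((pairCount m p v : ℝ) - (m : ℝ) ^ 2 / p)|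
      ≤ ∑ v ∈ S, 1 / p * ∑ h ∈ Finset.univ.erase (0 : ZMod p), F h * F (-(h * v)) :=
        (Finset.abs_sum_le_sum_abs _ _).trans (Finset.sum_le_sum fun v _ => hone v)
    _ = 1 / p * ∑ h ∈ Finset.univ.erase (0 : ZMod p), F h * ∑ v ∈ S, F (-(h * v)) := by
        rw [← Finset.mul_sum, Finset.sum_comm]
        simp only [Finset.mul_sum]
    _ ≤ 1 / p * ∑ h ∈ Finset.univ.erase (0 : ZMod p), F h * B := by
        gcongr with h hh
        exact hinner h hh
    _ = 1 / p * B ^ 2 := by rw [← Finset.sum_mul, ← hB]; ring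
    _ ≤ 1 / p * (p * (1 + Real.log p)) ^ 2 := by
        gcongr
        exact sum_norm_intervalSum_le m p
    _ = _ := by field_simp

lemma sum_pairCount_le (m : ℕ) {p : ℕ} [Fact p.Prime] (S : Finset (ZMod p)) :
    ∑ v ∈ S, pairCount m p v ≤ 2 * m ^ 2 := by
  have hfib : ∀ ab : ℕ × ℕ, (S.filter fun v => (ab.1 : ZMod p) = v * (ab.2 : ZMod p)).card ≤
      1 + p * if p ∣ ab.1 ∧ p ∣ ab.2 then 1 else 0 := by
    rintro ⟨a, b⟩
    dsimp only
    by_cases hb : (b : ZMod p) = 0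
    · by_cases ha : (a : ZMod p) = 0
      · rw [if_pos ⟨(ZMod.natCast_eq_zero_iff _ _).1 ha, (ZMod.natCast_eq_zero_iff _ _).1 hb⟩]
        have := Finset.card_le_univ (S.filter fun v => (a : ZMod p) = v * (b : ZMod p))
        rw [ZMod.card] at this
        omega
      · simp [hb, ha]
    · refine le_add_right (Finset.card_le_one.2 fun x hx y hy => ?_)
      exact mul_right_cancel₀ hb
        ((Finset.mem_filter.1 hx).2.symm.trans (Finset.mem_filter.1 hy).2)
  have hmul : ((Finset.Icc 1 m).filter fun a => p ∣ a).card = m / p :=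
    Nat.Ioc_filter_dvd_card_eq_div m p
  calc ∑ v ∈ S, pairCount m p v
      = ∑ ab ∈ Finset.Icc 1 m ×ˢ Finset.Icc 1 m,
          (S.filter fun v => (ab.1 : ZMod p) = v * (ab.2 : ZMod p)).card := by
        simp only [pairCount, Finset.card_filter]
        exact Finset.sum_comm
    _ ≤ ∑ ab ∈ Finset.Icc 1 m ×ˢ Finset.Icc 1 m,
          (1 + p * if p ∣ ab.1 ∧ p ∣ ab.2 then 1 else 0) := Finset.sum_le_sum fun ab _ => hfib ab
    _ = m ^ 2 + p * (m / p * (m / p)) := by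
        rw [Finset.sum_add_distrib, ← Finset.mul_sum, ← Finset.card_filter,
          Finset.filter_product (fun a => p ∣ a) (fun a => p ∣ a), Finset.card_product, hmul]
        simp [sq]
    _ ≤ m ^ 2 + m * m := by
        have h1 : p * (m / p) ≤ m := Nat.mul_div_le m p
        have h2 : m / p ≤ m := Nat.div_le_self m p
        rw [← mul_assoc]
        gcongr
    _ = _ := by ring

open ArithmeticFunction in
lemma sum_moebius_divisors_eq_ite {n N : ℕ} (hn : 0 < n) (hN : n ≤ N) :
    ∑ d ∈ (Finset.Icc 1 N).filter (· ∣ n), moebius d = if n = 1 then 1 else 0 := by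
  have h : (Finset.Icc 1 N).filter (· ∣ n) = n.divisors := by
    ext d
    simp only [Finset.mem_filter, Finset.mem_Icc, Nat.mem_divisors]
    constructor
    · exact fun h => ⟨h.2, hn.ne'⟩
    · exact fun h => ⟨⟨Nat.pos_of_dvd_of_pos h.1 hn, (Nat.le_of_dvd hn h.1).trans hN⟩, h.1⟩
  rw [h, ← coe_mul_zeta_apply, moebius_mul_coe_zeta, one_apply]

open ArithmeticFunction in
lemma card_coprime_eq_sum_moebius {A : Finset (ℕ × ℕ)} {n : ℕ}
    (hA : ∀ ab ∈ A, 0 < ab.1 ∧ ab.1 ≤ n) :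
    ((A.filter fun ab => Nat.Coprime ab.1 ab.2).card : ℤ) =
      ∑ d ∈ Finset.Icc 1 n, moebius d * ((A.filter fun ab => d ∣ ab.1 ∧ d ∣ ab.2).card : ℤ) := by
  simp only [Finset.card_filter, Nat.cast_sum, Finset.mul_sum]
  rw [Finset.sum_comm]
  refine Finset.sum_congr rfl fun ab hab => ?_
  obtain ⟨h0, h1⟩ := hA ab hab
  have hg : 0 < Nat.gcd ab.1 ab.2 := Nat.gcd_pos_of_pos_left _ h0
  have := sum_moebius_divisors_eq_ite hg ((Nat.gcd_le_left _ h0).trans h1)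
  rw [Finset.sum_filter] at this
  simp only [Nat.coprime_iff_gcd_eq_one, Nat.cast_ite, Nat.cast_one, Nat.cast_zero, mul_ite,
    mul_one, mul_zero, ← Nat.dvd_gcd_iff]
  exact this.symm

lemma card_filter_dvd_dilate (n : ℕ) {d : ℕ} (hd : 0 < d) (P : ℕ → ℕ → Prop)
    [∀ a b, Decidable (P a b)] :
    (((Finset.Icc 1 n ×ˢ Finset.Icc 1 n).filter fun ab => P ab.1 ab.2).filter
        fun ab => d ∣ ab.1 ∧ d ∣ ab.2).card =
      ((Finset.Icc 1 (n / d) ×ˢ Finset.Icc 1 (n / d)).filter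
        fun ab => P (d * ab.1) (d * ab.2)).card := by
  symm
  refine Finset.card_bij (fun ab _ => (d * ab.1, d * ab.2)) ?_ ?_ ?_
  · rintro ⟨a, b⟩ h
    simp only [Finset.mem_filter, Finset.mem_product, Finset.mem_Icc,
      Nat.le_div_iff_mul_le hd] at h ⊢
    obtain ⟨⟨⟨h1, h2⟩, h3, h4⟩, h5⟩ := h
    refine ⟨⟨⟨⟨Nat.mul_pos hd h1, by linarith⟩, Nat.mul_pos hd h3, by linarith⟩, h5⟩, ?_, ?_⟩ <;>
      exact dvd_mul_right _ _
  · rintro ⟨a, b⟩ _ ⟨a', b'⟩ _ h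
    simp only [Prod.mk.injEq, Nat.mul_right_inj hd.ne'] at h
    rw [h.1, h.2]
  · rintro ⟨a, b⟩ h
    simp only [Finset.mem_filter, Finset.mem_product, Finset.mem_Icc] at h
    obtain ⟨⟨⟨⟨h1, h2⟩, h3, h4⟩, h5⟩, ⟨a, rfl⟩, b, rfl⟩ := h
    refine ⟨(a, b), ?_, rfl⟩
    simp only [Finset.mem_filter, Finset.mem_product, Finset.mem_Icc, Nat.le_div_iff_mul_le hd]
    exact ⟨⟨⟨Nat.pos_of_mul_pos_left h1, by linarith⟩, Nat.pos_of_mul_pos_left h3, by linarith⟩, h5⟩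

/-- The number of `(a, b) ∈ [1, n]²` with `a = v * b` in `ZMod p` and `d ∣ a`, `d ∣ b`. -/
def pairCountDvd (n p d : ℕ) (v : ZMod p) : ℕ :=
  (((Finset.Icc 1 n ×ˢ Finset.Icc 1 n).filter
    fun ab => (ab.1 : ZMod p) = v * (ab.2 : ZMod p)).filter fun ab => d ∣ ab.1 ∧ d ∣ ab.2).card

lemma pairCountDvd_of_not_dvd (n : ℕ) {p d : ℕ} [Fact p.Prime] (hd : ¬ p ∣ d) (v : ZMod p) :
    pairCountDvd n p d v = pairCount (n / d) p v := by
  have hd0 : (d : ZMod p) ≠ 0 := by rwa [Ne, ZMod.natCast_eq_zero_iff]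
  have hpos : 0 < d := Nat.pos_of_ne_zero fun h => hd (h ▸ dvd_zero p)
  rw [pairCountDvd, card_filter_dvd_dilate n hpos fun a b => (a : ZMod p) = v * (b : ZMod p),
    pairCount]
  congr 1
  refine Finset.filter_congr fun ab _ => ?_
  push_cast
  rw [mul_left_comm]
  exact mul_right_inj' hd0

lemma pairCountDvd_of_dvd (n : ℕ) {p d : ℕ} (hpos : 0 < d) (hd : p ∣ d) (v : ZMod p) :
    pairCountDvd n p d v = (n / d) ^ 2 := by
  have hd0 : (d : ZMod p) = 0 := (ZMod.natCast_eq_zero_iff _ _).2 hd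
  rw [pairCountDvd, card_filter_dvd_dilate n hpos fun a b => (a : ZMod p) = v * (b : ZMod p)]
  simp [hd0, sq]

lemma RTp_le_sum_moebius (T : ℝ) (p : ℕ) (v : ℕ) :
    (RTp T p v : ℝ) ≤
      ∑ d ∈ Finset.Icc 1 ⌊T⌋₊, (ArithmeticFunction.moebius d : ℝ) * pairCountDvd ⌊T⌋₊ p d v := by
  set n := ⌊T⌋₊
  have h := card_coprime_eq_sum_moebius (n := n)
    (A := (Finset.Icc 1 n ×ˢ Finset.Icc 1 n).filter
      fun ab => (ab.1 : ZMod p) = (v : ZMod p) * (ab.2 : ZMod p)) (by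
      intro ab hab
      simp only [Finset.mem_filter, Finset.mem_product, Finset.mem_Icc] at hab
      exact hab.1.1)
  have h' : (RTp T p v : ℤ) ≤
      ∑ d ∈ Finset.Icc 1 n, ArithmeticFunction.moebius d * (pairCountDvd n p d v : ℤ) := by
    unfold pairCountDvd
    rw [← h, Nat.cast_le]
    refine Finset.card_le_card fun ab hab => ?_
    simp only [Finset.mem_filter, Int.cast_natCast] at hab ⊢
    exact ⟨⟨hab.1, hab.2.2.2⟩, hab.2.1⟩
  exact_mod_cast h'

open ArithmeticFunction in
lemma hasSum_moebius_div_sq :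
    HasSum (fun n : ℕ => (moebius n : ℝ) / (n : ℝ) ^ 2) (6 / Real.pi ^ 2) := by
  have h2 : 1 < (2 : ℂ).re := by norm_num
  have hL : LSeries (fun n => ((moebius n : ℤ) : ℂ)) 2 = ((6 / Real.pi ^ 2 : ℝ) : ℂ) := by
    have h := LSeries_zeta_mul_Lseries_moebius h2
    rw [LSeries_zeta_eq_riemannZeta h2, riemannZeta_two] at h
    have hpi : (Real.pi : ℂ) ≠ 0 := by exact_mod_cast Real.pi_ne_zero
    push_cast
    field_simp at h ⊢
    linear_combination h
  have hs := (LSeriesSummable_moebius_iff.2 h2).LSeriesHasSum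
  rw [hL] at hs
  rw [← Complex.hasSum_ofReal]
  refine HasSum.congr_fun hs fun n => ?_
  rcases eq_or_ne n 0 with rfl | hn
  · simp
  · rw [LSeries.term_of_ne_zero hn]
    norm_cast

open ArithmeticFunction in
lemma sum_moebius_div_sq_le (n : ℕ) :
    ∑ d ∈ Finset.Icc 1 n, (moebius d : ℝ) / (d : ℝ) ^ 2 ≤ 6 / Real.pi ^ 2 + 2 / (n + 1) := by
  have hμ : ∀ d : ℕ, |(moebius d : ℝ)| ≤ 1 := fun d => by
    exact_mod_cast abs_moebius_le_one (n := d)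
  have ht := (hasSum_moebius_div_sq.tendsto_sum_nat).add_const (2 / ((n : ℝ) + 1))
  refine ge_of_tendsto ht ?_
  filter_upwards [Filter.eventually_gt_atTop n] with N hN
  have hsub : Finset.Icc 1 n ⊆ Finset.range N := fun d hd => by
    simp only [Finset.mem_Icc, Finset.mem_range] at hd ⊢; omega
  rw [← Finset.sum_sdiff hsub]
  have hz : ∀ d ∈ Finset.range N \ Finset.Icc 1 n, d ∉ Finset.Ioo n N →
      |(moebius d : ℝ) / (d : ℝ) ^ 2| = 0 := by
    intro d hd hd'
    simp only [Finset.mem_sdiff, Finset.mem_range, Finset.mem_Icc, Finset.mem_Ioo] at hd hd'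
    have : d = 0 := by omega
    simp [this]
  have hsub' : Finset.Ioo n N ⊆ Finset.range N \ Finset.Icc 1 n := fun d hd => by
    simp only [Finset.mem_sdiff, Finset.mem_range, Finset.mem_Icc, Finset.mem_Ioo] at hd ⊢; omega
  have htail : |∑ d ∈ Finset.range N \ Finset.Icc 1 n, (moebius d : ℝ) / (d : ℝ) ^ 2| ≤
      2 / ((n : ℝ) + 1) := by
    refine (Finset.abs_sum_le_sum_abs _ _).trans ?_
    rw [← Finset.sum_subset hsub' hz]
    refine le_trans (Finset.sum_le_sum fun d _ => ?_) (sum_Ioo_inv_sq_le n N)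
    rw [abs_div, abs_of_nonneg (sq_nonneg (d : ℝ)), ← one_div]
    gcongr
    exact hμ d
  linarith [(abs_le.1 htail).1]

lemma abs_natDiv_sq_sub_le (n : ℕ) {d : ℕ} (hd : 0 < d) :
    |((n / d : ℕ) : ℝ) ^ 2 - (n : ℝ) ^ 2 / (d : ℝ) ^ 2| ≤ 2 * n * (1 / d) := by
  have hd' : (0 : ℝ) < d := by exact_mod_cast hd
  have h1 : ((n / d : ℕ) : ℝ) ≤ (n : ℝ) / d := Nat.cast_div_le
  have h2 : (n : ℝ) / d ≤ (n / d : ℕ) + 1 := by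
    rw [div_le_iff₀ hd']
    exact_mod_cast (Nat.lt_div_mul_add hd (a := n)).le.trans_eq (by ring)
  have h0 : (0 : ℝ) ≤ (n / d : ℕ) := Nat.cast_nonneg _
  have e : 2 * (n : ℝ) * (1 / d) = 2 * ((n : ℝ) / d) := by ring
  rw [← div_pow, e, abs_le]
  constructor <;> nlinarith

open ArithmeticFunction in
lemma sum_moebius_mul_natDiv_sq_le (n : ℕ) :
    ∑ d ∈ Finset.Icc 1 n, (moebius d : ℝ) * ((n / d : ℕ) : ℝ) ^ 2 ≤
      6 / Real.pi ^ 2 * (n : ℝ) ^ 2 + 2 * n + 2 * n * (1 + Real.log n) := by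
  have hμ : ∀ d : ℕ, |(moebius d : ℝ)| ≤ 1 := fun d => by
    exact_mod_cast abs_moebius_le_one (n := d)
  have hterm : ∀ d ∈ Finset.Icc 1 n, (moebius d : ℝ) * ((n / d : ℕ) : ℝ) ^ 2 ≤
      (n : ℝ) ^ 2 * ((moebius d : ℝ) / (d : ℝ) ^ 2) + 2 * n * (1 / d) := by
    intro d hd
    have h := abs_natDiv_sq_sub_le n (Finset.mem_Icc.1 hd).1
    have h' : (moebius d : ℝ) * (((n / d : ℕ) : ℝ) ^ 2 - (n : ℝ) ^ 2 / (d : ℝ) ^ 2) ≤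
        2 * n * (1 / d) := by
      refine (le_abs_self _).trans ?_
      rw [abs_mul]
      calc _ ≤ 1 * |((n / d : ℕ) : ℝ) ^ 2 - (n : ℝ) ^ 2 / (d : ℝ) ^ 2| := by
            gcongr; exact hμ d
        _ ≤ _ := by rwa [one_mul]
    have e : (n : ℝ) ^ 2 * ((moebius d : ℝ) / (d : ℝ) ^ 2) =
        (moebius d : ℝ) * ((n : ℝ) ^ 2 / (d : ℝ) ^ 2) := by ring
    rw [e]
    linarith
  refine (Finset.sum_le_sum hterm).trans ?_
  rw [Finset.sum_add_distrib, ← Finset.mul_sum, ← Finset.mul_sum]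
  have h1 := mul_le_mul_of_nonneg_left (sum_moebius_div_sq_le n) (sq_nonneg (n : ℝ))
  have h2 : 2 * (n : ℝ) * ∑ d ∈ Finset.Icc 1 n, 1 / (d : ℝ) ≤ 2 * n * (1 + Real.log n) := by
    gcongr
    exact sum_Icc_one_div_le n
  have h3 : (n : ℝ) ^ 2 * (2 / (n + 1)) ≤ 2 * n := by
    rw [mul_div_assoc', div_le_iff₀ (by positivity)]
    nlinarith [Nat.cast_nonneg (α := ℝ) n]
  linarith

lemma abs_sum_pairCountDvd_sub_le (n D : ℕ) {p d : ℕ} [Fact p.Prime] (hd : 0 < d)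
    {S : Finset (ZMod p)} (hS : 0 ∉ S) :
    |∑ v ∈ S, ((pairCountDvd n p d v : ℝ) - ((n / d : ℕ) : ℝ) ^ 2 / p)| ≤
      (if d ≤ D then p * (1 + Real.log p) ^ 2 else 2 * (n : ℝ) ^ 2 * ((d : ℝ) ^ 2)⁻¹) +
        if p ∣ d then p * (n : ℝ) ^ 2 * ((d : ℝ) ^ 2)⁻¹ else 0 := by
  have hp : (0 : ℝ) < p := Nat.cast_pos.2 (NeZero.pos p)
  have hp1 : (1 : ℝ) ≤ p := by exact_mod_cast NeZero.pos p
  have hcard : (S.card : ℝ) ≤ p := by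
    have := Finset.card_le_univ S
    rw [ZMod.card] at this
    exact_mod_cast this
  have hfloor : ((n / d : ℕ) : ℝ) ^ 2 ≤ (n : ℝ) ^ 2 * ((d : ℝ) ^ 2)⁻¹ := by
    rw [← div_eq_mul_inv, ← div_pow]
    gcongr
    exact Nat.cast_div_le
  set m : ℝ := ((n / d : ℕ) : ℝ) with hm
  have hE : 0 ≤ (if d ≤ D then p * (1 + Real.log p) ^ 2
      else 2 * (n : ℝ) ^ 2 * ((d : ℝ) ^ 2)⁻¹) := by
    split_ifs <;> positivity
  by_cases hpd : p ∣ d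
  · rw [if_pos hpd]
    simp only [pairCountDvd_of_dvd n hd hpd, Finset.sum_const, nsmul_eq_mul, Nat.cast_pow, ← hm]
    have h0 : 0 ≤ m ^ 2 - m ^ 2 / p := sub_nonneg.2 (div_le_self (sq_nonneg m) hp1)
    rw [abs_of_nonneg (by positivity)]
    have h1 : (S.card : ℝ) * (m ^ 2 - m ^ 2 / p) ≤ p * m ^ 2 := by
      gcongr
      linarith [div_nonneg (sq_nonneg m) hp.le]
    have h2 := mul_le_mul_of_nonneg_left hfloor hp.le
    rw [← mul_assoc] at h2
    linarith
  · rw [if_neg hpd, add_zero]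
    simp only [pairCountDvd_of_not_dvd n hpd]
    split_ifs with hdD
    · exact abs_sum_pairCount_sub_le (n / d) hS
    · have h1 : (∑ v ∈ S, (pairCount (n / d) p v : ℝ)) ≤ 2 * m ^ 2 := by
        rw [hm]
        exact_mod_cast sum_pairCount_le (n / d) S
      have h2 : (0 : ℝ) ≤ ∑ v ∈ S, (pairCount (n / d) p v : ℝ) :=
        Finset.sum_nonneg fun _ _ => Nat.cast_nonneg _
      have h3 : (S.card : ℝ) * (m ^ 2 / p) ≤ m ^ 2 := by
        calc (S.card : ℝ) * (m ^ 2 / p) ≤ p * (m ^ 2 / p) := by gcongr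
          _ = m ^ 2 := by field_simp
      have h4 : 0 ≤ (S.card : ℝ) * (m ^ 2 / p) := by positivity
      rw [Finset.sum_sub_distrib, Finset.sum_const, nsmul_eq_mul, abs_le]
      constructor <;> linarith

lemma sum_Icc_inv_sq_le_two (n : ℕ) : ∑ k ∈ Finset.Icc 1 n, ((k : ℝ) ^ 2)⁻¹ ≤ 2 := by
  have h := sum_Ioo_inv_sq_le (α := ℝ) 0 (n + 1)
  have e : Finset.Ioo 0 (n + 1) = Finset.Icc 1 n := by
    ext k; simp only [Finset.mem_Ioo, Finset.mem_Icc]; omega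
  rw [e] at h
  norm_num at h
  simpa using h

lemma sum_ite_dvd_inv_sq_le (n : ℕ) {p : ℕ} (hp : 0 < p) :
    ∑ d ∈ Finset.Icc 1 n, (if p ∣ d then p * (n : ℝ) ^ 2 * ((d : ℝ) ^ 2)⁻¹ else 0) ≤
      2 * ((n : ℝ) ^ 2 / p) := by
  have hp' : (0 : ℝ) < p := by exact_mod_cast hp
  rw [← Finset.sum_filter]
  have hsub : (Finset.Icc 1 n).filter (p ∣ ·) ⊆ (Finset.Icc 1 n).image (p * ·) := by
    intro d hd
    simp only [Finset.mem_filter, Finset.mem_Icc] at hd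
    obtain ⟨⟨h1, h2⟩, k, rfl⟩ := hd
    exact Finset.mem_image.2 ⟨k, Finset.mem_Icc.2
      ⟨Nat.pos_of_mul_pos_left h1, (Nat.le_mul_of_pos_left k hp).trans h2⟩, rfl⟩
  refine (Finset.sum_le_sum_of_subset_of_nonneg hsub fun _ _ _ => by positivity).trans ?_
  rw [Finset.sum_image fun a _ b _ h => Nat.eq_of_mul_eq_mul_left hp h]
  calc ∑ k ∈ Finset.Icc 1 n, p * (n : ℝ) ^ 2 * (((p * k : ℕ) : ℝ) ^ 2)⁻¹
      = (n : ℝ) ^ 2 / p * ∑ k ∈ Finset.Icc 1 n, ((k : ℝ) ^ 2)⁻¹ := by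
        rw [Finset.mul_sum]
        refine Finset.sum_congr rfl fun k _ => ?_
        push_cast
        rw [mul_pow, mul_inv]
        field_simp
    _ ≤ (n : ℝ) ^ 2 / p * 2 := by
        gcongr
        exact sum_Icc_inv_sq_le_two n
    _ = _ := mul_comm _ _

lemma sum_ite_le_inv_sq_le (n D : ℕ) {E : ℝ} (hE : 0 ≤ E) :
    ∑ d ∈ Finset.Icc 1 n, (if d ≤ D then E else 2 * (n : ℝ) ^ 2 * ((d : ℝ) ^ 2)⁻¹) ≤
      D * E + 4 * (n : ℝ) ^ 2 / (D + 1) := by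
  rw [Finset.sum_ite, Finset.sum_const, nsmul_eq_mul, ← Finset.mul_sum]
  have h1 : ((Finset.Icc 1 n).filter (· ≤ D)).card ≤ D := by
    calc _ ≤ (Finset.Icc 1 D).card := Finset.card_le_card fun d hd => by
            simp only [Finset.mem_filter, Finset.mem_Icc] at hd ⊢; omega
      _ = D := by simp
  have h2 : ∑ d ∈ (Finset.Icc 1 n).filter (¬ · ≤ D), ((d : ℝ) ^ 2)⁻¹ ≤ 2 / (D + 1) := by
    refine le_trans (Finset.sum_le_sum_of_subset_of_nonneg (fun d hd => ?_)
      fun _ _ _ => by positivity) (sum_Ioo_inv_sq_le D (n + 1))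
    simp only [Finset.mem_filter, Finset.mem_Icc, Finset.mem_Ioo] at hd ⊢; omega
  have e : 4 * (n : ℝ) ^ 2 / (D + 1) = 2 * (n : ℝ) ^ 2 * (2 / (D + 1)) := by ring
  rw [e]
  gcongr

open ArithmeticFunction in
lemma sum_sum_moebius_pairCountDvd_le (n D : ℕ) {p : ℕ} [Fact p.Prime]
    {S : Finset (ZMod p)} (hS : 0 ∉ S) :
    ∑ v ∈ S, ∑ d ∈ Finset.Icc 1 n, (moebius d : ℝ) * pairCountDvd n p d v ≤
      S.card / p * ∑ d ∈ Finset.Icc 1 n, (moebius d : ℝ) * ((n / d : ℕ) : ℝ) ^ 2 +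
        (D * (p * (1 + Real.log p) ^ 2) + 4 * (n : ℝ) ^ 2 / (D + 1)) +
          2 * ((n : ℝ) ^ 2 / p) := by
  have hp : (0 : ℝ) < p := Nat.cast_pos.2 (NeZero.pos p)
  have hμ : ∀ d : ℕ, |(moebius d : ℝ)| ≤ 1 := fun d => by
    exact_mod_cast abs_moebius_le_one (n := d)
  set W : ℕ → ℝ := fun d =>
    ∑ v ∈ S, ((pairCountDvd n p d v : ℝ) - ((n / d : ℕ) : ℝ) ^ 2 / p) with hW
  have hsplit : ∑ v ∈ S, ∑ d ∈ Finset.Icc 1 n, (moebius d : ℝ) * pairCountDvd n p d v =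
      S.card / p * ∑ d ∈ Finset.Icc 1 n, (moebius d : ℝ) * ((n / d : ℕ) : ℝ) ^ 2 +
        ∑ d ∈ Finset.Icc 1 n, (moebius d : ℝ) * W d := by
    rw [Finset.sum_comm, Finset.mul_sum, ← Finset.sum_add_distrib]
    refine Finset.sum_congr rfl fun d _ => ?_
    rw [hW, ← Finset.mul_sum]
    simp only [Finset.sum_sub_distrib, Finset.sum_const, nsmul_eq_mul]
    ring
  rw [hsplit, add_assoc]
  gcongr
  calc ∑ d ∈ Finset.Icc 1 n, (moebius d : ℝ) * W d
      ≤ ∑ d ∈ Finset.Icc 1 n, |W d| := by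
        refine Finset.sum_le_sum fun d _ => (le_abs_self _).trans ?_
        rw [abs_mul]
        exact mul_le_of_le_one_left (abs_nonneg _) (hμ d)
    _ ≤ _ := Finset.sum_le_sum fun d hd =>
        abs_sum_pairCountDvd_sub_le n D (Finset.mem_Icc.1 hd).1 hS
    _ ≤ _ := by
        rw [Finset.sum_add_distrib]
        exact add_le_add (sum_ite_le_inv_sq_le n D (by positivity))
          (sum_ite_dvd_inv_sq_le n (NeZero.pos p))

lemma one_add_log_le {T : ℝ} (hT : 1 ≤ T) {p : ℝ} (hp : 1 ≤ p) :
    1 + Real.log T ≤ 4 * (√p + T / p) := by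
  have hT0 : 0 < T := by linarith
  have hp0 : 0 < p := by linarith
  have h1 := Real.log_le_rpow_div hT0.le (ε := 1 / 3) (by norm_num)
  have h2 : 1 ≤ T ^ (1 / 3 : ℝ) := Real.one_le_rpow hT (by norm_num)
  have h3 : T ^ (1 / 3 : ℝ) ≤ √p + T / p := by
    have h := Real.geom_mean_le_arith_mean2_weighted (w₁ := 2 / 3) (w₂ := 1 / 3)
      (by norm_num) (by norm_num) (Real.sqrt_nonneg p) (div_pos hT0 hp0).le (by norm_num)
    have e : √p ^ (2 / 3 : ℝ) * (T / p) ^ (1 / 3 : ℝ) = T ^ (1 / 3 : ℝ) := by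
      rw [Real.sqrt_eq_rpow, ← Real.rpow_mul hp0.le, Real.div_rpow hT0.le hp0.le]
      norm_num
      field_simp
    rw [e] at h
    have := Real.sqrt_nonneg p
    have := (div_pos hT0 hp0).le
    linarith
  linarith

lemma one_add_log_sq_le {p ε : ℝ} (hp : 1 ≤ p) (hε : 0 < ε) :
    (1 + Real.log p) ^ 2 ≤ (1 + 2 / ε) ^ 2 * p ^ ε := by
  have hp0 : 0 < p := by linarith
  have h1 := Real.log_le_rpow_div hp0.le (half_pos hε)
  have h2 : 1 ≤ p ^ (ε / 2) := Real.one_le_rpow hp (half_pos hε).le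
  have h3 : 0 ≤ Real.log p := Real.log_nonneg hp
  have e : p ^ ε = (p ^ (ε / 2)) ^ 2 := by
    rw [← Real.rpow_natCast, ← Real.rpow_mul hp0.le]
    norm_num
  rw [e, ← mul_pow]
  gcongr
  calc 1 + Real.log p ≤ p ^ (ε / 2) + p ^ (ε / 2) / (ε / 2) := by gcongr
    _ = _ := by field_simp

/-- For every `ε > 0` there is `C > 0` such that for all primes `p`, all real
`T ≥ 1`, and every subset `S ⊆ {1, …, p−1}`,
`Σ_{v∈S} R_{T,p}(v) ≤ (6/π²)·(T²/p)·#S + C·(T²·p⁻¹ + T·p^{1/2+ε})`. -/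
theorem sum_RTp_over_subset_bound (ε : ℝ) (hε : 0 < ε) :
    ∃ C : ℝ, 0 < C ∧ ∀ p : ℕ, p.Prime → ∀ T : ℝ, 1 ≤ T →
      ∀ S : Finset ℕ, S ⊆ Finset.Icc 1 (p - 1) →
        ∑ v ∈ S, ((RTp T p (v : ℤ)) : ℝ) ≤
          6 / Real.pi ^ 2 * (T ^ 2 / p) * S.card +
            C * (T ^ 2 / p + T * (p : ℝ) ^ ((1 : ℝ) / 2 + ε)) := by
  refine ⟨16 + (1 + 2 / ε) ^ 2, by positivity, fun p hp T hT S hS => ?_⟩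
  have : Fact p.Prime := ⟨hp⟩
  have hp0 : (0 : ℝ) < p := by exact_mod_cast hp.pos
  have hp1 : (1 : ℝ) ≤ p := by exact_mod_cast hp.one_lt.le
  have hT0 : 0 < T := by linarith
  set n := ⌊T⌋₊ with hn
  have hnT : (n : ℝ) ≤ T := Nat.floor_le hT0.le
  have hn1 : 1 ≤ n := Nat.le_floor (by simpa using hT)
  have hn1' : (1 : ℝ) ≤ n := by exact_mod_cast hn1
  have hsp : 0 < √(p : ℝ) := Real.sqrt_pos.2 hp0
  have hsq : √(p : ℝ) * √(p : ℝ) = p := Real.mul_self_sqrt hp0.le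
  have hsp1 : 1 ≤ √(p : ℝ) := Real.one_le_sqrt.2 hp1
  have hlt : ∀ v ∈ S, 0 < v ∧ v < p := fun v hv => by
    have := Finset.mem_Icc.1 (hS hv); have := hp.pos; omega
  have hinj : Set.InjOn (fun v : ℕ => (v : ZMod p)) S := by
    intro a ha b hb hab
    have := congrArg ZMod.val hab
    rwa [ZMod.val_cast_of_lt (hlt a ha).2, ZMod.val_cast_of_lt (hlt b hb).2] at this
  set S' : Finset (ZMod p) := S.image fun v : ℕ => (v : ZMod p) with hS'
  have hS0 : (0 : ZMod p) ∉ S' := by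
    intro h
    obtain ⟨v, hv, hv0⟩ := Finset.mem_image.1 h
    exact Nat.not_dvd_of_pos_of_lt (hlt v hv).1 (hlt v hv).2 ((ZMod.natCast_eq_zero_iff _ _).1 hv0)
  have hcard : S'.card = S.card := Finset.card_image_of_injOn hinj
  have hcardp : (S.card : ℝ) / p ≤ 1 := by
    rw [div_le_one hp0, ← hcard]
    have := Finset.card_le_univ S'
    rw [ZMod.card] at this
    exact_mod_cast this
  set D := ⌊T / √(p : ℝ)⌋₊ with hD
  have hD1 : (D : ℝ) ≤ T / √(p : ℝ) := Nat.floor_le (by positivity)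
  have hD2 : T / √(p : ℝ) ≤ D + 1 := (Nat.lt_floor_add_one _).le
  have hmain := sum_sum_moebius_pairCountDvd_le n D hS0
  rw [hS', Finset.sum_image hinj, ← hS', hcard] at hmain
  have hR : ∑ v ∈ S, ((RTp T p (v : ℤ)) : ℝ) ≤ ∑ v ∈ S, ∑ d ∈ Finset.Icc 1 n,
      (ArithmeticFunction.moebius d : ℝ) * pairCountDvd n p d v :=
    Finset.sum_le_sum fun v _ => RTp_le_sum_moebius T p v
  have hlog : (n : ℝ) * (1 + Real.log n) ≤ T * (4 * (√(p : ℝ) + T / p)) := by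
    have : 0 ≤ Real.log n := Real.log_nonneg hn1'
    calc (n : ℝ) * (1 + Real.log n) ≤ T * (1 + Real.log T) := by gcongr
      _ ≤ _ := by gcongr; exact one_add_log_le hT hp1
  have hA : (S.card : ℝ) / p * ∑ d ∈ Finset.Icc 1 n,
      (ArithmeticFunction.moebius d : ℝ) * ((n / d : ℕ) : ℝ) ^ 2 ≤
        6 / Real.pi ^ 2 * (T ^ 2 / p) * S.card +
          (2 * T + 2 * (T * (4 * (√(p : ℝ) + T / p)))) := by
    have hlog0 : 0 ≤ Real.log n := Real.log_nonneg hn1'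
    calc _ ≤ (S.card : ℝ) / p *
          (6 / Real.pi ^ 2 * (n : ℝ) ^ 2 + 2 * n + 2 * n * (1 + Real.log n)) := by
          gcongr
          exact sum_moebius_mul_natDiv_sq_le n
      _ = (S.card : ℝ) / p * (6 / Real.pi ^ 2 * (n : ℝ) ^ 2) +
          (S.card : ℝ) / p * (2 * n + 2 * (n * (1 + Real.log n))) := by ring
      _ ≤ (S.card : ℝ) / p * (6 / Real.pi ^ 2 * T ^ 2) +
          1 * (2 * T + 2 * (T * (4 * (√(p : ℝ) + T / p)))) := by gcongr
      _ = _ := by ring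
  have hpow : (p : ℝ) ^ ((1 : ℝ) / 2 + ε) = √(p : ℝ) * (p : ℝ) ^ ε := by
    rw [Real.rpow_add hp0, Real.sqrt_eq_rpow]
  have hpe : 1 ≤ (p : ℝ) ^ ε := Real.one_le_rpow hp1 hε.le
  have hB : (D : ℝ) * (p * (1 + Real.log p) ^ 2) ≤
      (1 + 2 / ε) ^ 2 * (T * (√(p : ℝ) * (p : ℝ) ^ ε)) := by
    calc (D : ℝ) * (p * (1 + Real.log p) ^ 2)
        ≤ T / √(p : ℝ) * (p * ((1 + 2 / ε) ^ 2 * (p : ℝ) ^ ε)) := by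
          gcongr
          exact one_add_log_sq_le hp1 hε
      _ = T / √(p : ℝ) * (√(p : ℝ) * √(p : ℝ) * ((1 + 2 / ε) ^ 2 * (p : ℝ) ^ ε)) := by rw [hsq]
      _ = _ := by field_simp
  have hC : 4 * (n : ℝ) ^ 2 / (D + 1) ≤ 4 * (T * √(p : ℝ)) := by
    calc 4 * (n : ℝ) ^ 2 / (D + 1) ≤ 4 * T ^ 2 / (T / √(p : ℝ)) := by gcongr
      _ = _ := by field_simp
  have hE : (n : ℝ) ^ 2 / p ≤ T ^ 2 / p := by gcongr
  have hF : T * √(p : ℝ) ≤ T * (√(p : ℝ) * (p : ℝ) ^ ε) := by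
    gcongr
    exact le_mul_of_one_le_right hsp.le hpe
  have hG : T ≤ T * √(p : ℝ) := le_mul_of_one_le_right hT0.le hsp1
  have hH : T * (4 * (√(p : ℝ) + T / p)) = 4 * (T * √(p : ℝ)) + 4 * (T ^ 2 / p) := by ring
  have hI : 0 ≤ (1 + 2 / ε) ^ 2 * (T ^ 2 / p) := by positivity
  have hJ : 0 ≤ T ^ 2 / p := by positivity
  rw [hpow]
  rw [hH] at hA
  have := hR.trans hmain
  nlinarith
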